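/- Assume the reduced system is uncontrolled, y′(τ) = f(y(τ)), Assumption III holds, the map z ↦ Y_z is Lipschitz on Z in the Hausdorff metric, and the periods satisfy |T_{z′} − T_{z″}| / max{T_{z′}, T_{z″}} ≤ L̃ ‖z′ − z″‖ for all z′, z″ ∈ Z and some constant L̃. Then the map z ↦ W(z) is continuous on Z and the set-valued map V(z) := {(h̃(μ), r̃(μ)) : μ ∈ W(z)} ⊂ ℝ^{k+1} is Lipschitz on Z in the Hausdorff metric. -/

import Mathlib

open MeasureTheory Set Filter Metric
open scoped ENNReal NNReal Topology

noncomputable section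

namespace SlowObs

abbrev Dd (d : ℕ) := EuclideanSpace ℝ (Fin d)
abbrev Em (m : ℕ) := EuclideanSpace ℝ (Fin m)
abbrev Kk (k : ℕ) := EuclideanSpace ℝ (Fin k)

variable {d m k : ℕ}

/-- A control: a measurable function with values in `U` at nonnegative times. -/
def IsControl (U : Set (Dd d)) (u : ℝ → Dd d) : Prop :=
  Measurable u ∧ ∀ t : ℝ, 0 ≤ t → u t ∈ U

/-- Carathéodory (integral-form) solution of `y'(t) = vf t (y t)` on `[0, ∞)`. -/
def IsSolOn (vf : ℝ → Em m → Em m) (y : ℝ → Em m) : Prop :=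
  ContinuousOn y (Ici 0) ∧
    (∀ T : ℝ, IntervalIntegrable (fun s => vf s (y s)) volume 0 T) ∧
    ∀ t : ℝ, 0 ≤ t → y t = y 0 + ∫ s in (0:ℝ)..t, vf s (y s)

/-- The level sets `Y_z = {y : F y = z}` (invariant sets of the reduced system). -/
def lvl (F : Em m → Kk k) (z : Kk k) : Set (Em m) := {y | F y = z}

/-- `h(u,y) := F'(y) g(u,y)`. -/
def hObs (F : Em m → Kk k) (g : Dd d → Em m → Em m) (p : Dd d × Em m) : Kk k :=
  fderiv ℝ F p.2 (g p.1 p.2)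

/-- Occupational measure generated on `[0,S]` by the pair `(u(·), y(·))`:
the pushforward of the normalized Lebesgue measure on `[0,S]` under `τ ↦ (u τ, y τ)`. -/
def occ (u : ℝ → Dd d) (y : ℝ → Em m) (S : ℝ) : Measure (Dd d × Em m) :=
  (ENNReal.ofReal S)⁻¹ • Measure.map (fun τ => (u τ, y τ)) (volume.restrict (Ioc 0 S))

/-- The set `W(z)`. -/
def W (U : Set (Dd d)) (f : Dd d → Em m → Em m) (F : Em m → Kk k) (z : Kk k) :
    Set (Measure (Dd d × Em m)) :=
  {μ | IsProbabilityMeasure μ ∧ μ (U ×ˢ lvl F z) = 1 ∧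
    ∀ φ : Em m → ℝ, ContDiff ℝ 1 φ → ∫ p, fderiv ℝ φ p.2 (f p.1 p.2) ∂μ = 0}

/-- The metric `ρ` on probability measures: the Lévy–Prokhorov (extended) distance. -/
def ρ (μ ν : Measure (Dd d × Em m)) : ℝ≥0∞ := levyProkhorovEDist μ ν

/-- Distance from a measure to a set of measures, `ρ(μ, Γ) = inf_{ν ∈ Γ} ρ(μ,ν)`. -/
def ρpt (μ : Measure (Dd d × Em m)) (Γ : Set (Measure (Dd d × Em m))) : ℝ≥0∞ :=
  ⨅ ν ∈ Γ, ρ μ ν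

/-- The Hausdorff semimetric `ρ_H` on sets of measures. -/
def ρH (Γ₁ Γ₂ : Set (Measure (Dd d × Em m))) : ℝ≥0∞ :=
  max (⨆ μ ∈ Γ₁, ρpt μ Γ₂) (⨆ μ ∈ Γ₂, ρpt μ Γ₁)

/-- Continuity of the set-valued map `z ↦ W(z)` on `Z` with respect to `ρ_H`. -/
def WCont (U : Set (Dd d)) (f : Dd d → Em m → Em m) (F : Em m → Kk k)
    (Z : Set (Kk k)) : Prop :=
  ∀ z ∈ Z, ∀ δ : ℝ≥0∞, 0 < δ → ∃ ε > (0:ℝ), ∀ z' ∈ Z, ‖z' - z‖ < ε →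
    ρH (W U f F z') (W U f F z) < δ

/-- `h̃(μ) = ∫ h dμ`. -/
def htilde (F : Em m → Kk k) (g : Dd d → Em m → Em m) (μ : Measure (Dd d × Em m)) : Kk k :=
  ∫ p, hObs F g p ∂μ

/-- `r̃(μ) = ∫ r dμ`. -/
def rtilde (r : Dd d → Em m → ℝ) (μ : Measure (Dd d × Em m)) : ℝ :=
  ∫ p, r p.1 p.2 ∂μ

/-- The set-valued map `V(z) = {(h̃ μ, r̃ μ) : μ ∈ W(z)} ⊆ ℝ^{k+1}`. -/
def Vmap (U : Set (Dd d)) (f : Dd d → Em m → Em m) (F : Em m → Kk k)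
    (g : Dd d → Em m → Em m) (r : Dd d → Em m → ℝ) (z : Kk k) : Set (Kk k × ℝ) :=
  (fun μ => (htilde F g μ, rtilde r μ)) '' W U f F z

/-- Lipschitz continuity of `V` on `Z` in the Hausdorff metric. -/
def VLip (U : Set (Dd d)) (f : Dd d → Em m → Em m) (F : Em m → Kk k)
    (g : Dd d → Em m → Em m) (r : Dd d → Em m → ℝ) (Z : Set (Kk k)) : Prop :=
  ∃ L : ℝ, 0 ≤ L ∧ ∀ z' ∈ Z, ∀ z'' ∈ Z,
    hausdorffDist (Vmap U f F g r z') (Vmap U f F g r z'') ≤ L * ‖z' - z''‖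

/-- A solution `(μ(·), z(·))` of the averaged system with initial value `z₀`. -/
def IsAveragedSol (U : Set (Dd d)) (f : Dd d → Em m → Em m) (F : Em m → Kk k)
    (g : Dd d → Em m → Em m) (z₀ : Kk k)
    (μt : ℝ → Measure (Dd d × Em m)) (z : ℝ → Kk k) : Prop :=
  z 0 = z₀ ∧ ContinuousOn z (Ici 0) ∧
    (∀ T : ℝ, IntervalIntegrable (fun s => htilde F g (μt s)) volume 0 T) ∧
    (∀ t : ℝ, 0 ≤ t → z t = z₀ + ∫ s in (0:ℝ)..t, htilde F g (μt s)) ∧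
    (∀ t : ℝ, 0 ≤ t → μt t ∈ W U f F (z t))

/-- Viability of the averaged system in `Z`. -/
def AveragedViable (U : Set (Dd d)) (f : Dd d → Em m → Em m) (F : Em m → Kk k)
    (g : Dd d → Em m → Em m) (Z : Set (Kk k)) : Prop :=
  ∀ z₀ ∈ Z, ∃ μt zf, IsAveragedSol U f F g z₀ μt zf ∧ ∀ t : ℝ, 0 ≤ t → zf t ∈ Z

/-- Viability of the augmented perturbed system in `Y × Z`. -/
def AugViable (U : Set (Dd d)) (f g : Dd d → Em m → Em m) (F : Em m → Kk k)
    (Yset : Set (Em m)) (Z : Set (Kk k)) : Prop :=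
  ∀ ε > (0:ℝ), ∀ y₀ ∈ Yset, ∀ z₀ ∈ Z, ∃ u y zf,
    IsControl U u ∧ IsSolOn (fun s x => ε⁻¹ • f (u s) x + g (u s) x) y ∧ y 0 = y₀ ∧
    ContinuousOn zf (Ici 0) ∧ zf 0 = z₀ ∧
    (∀ T : ℝ, IntervalIntegrable (fun s => hObs F g (u s, y s)) volume 0 T) ∧
    (∀ t : ℝ, 0 ≤ t → zf t = z₀ + ∫ s in (0:ℝ)..t, hObs F g (u s, y s)) ∧
    (∀ t : ℝ, 0 ≤ t → y t ∈ Yset ∧ zf t ∈ Z)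

/-- The set `M_z(S, y₀)` of occupational measures on `[0,S]` of reduced solutions from `y₀`. -/
def Mz (U : Set (Dd d)) (f : Dd d → Em m → Em m) (S : ℝ) (y₀ : Em m) :
    Set (Measure (Dd d × Em m)) :=
  {μ | ∃ u y, IsControl U u ∧ IsSolOn (fun s x => f (u s) x) y ∧ y 0 = y₀ ∧ μ = occ u y S}

/-- Assumption 2 of the paper: `sup_{μ ∈ W(z)} ρ(μ, M_z(S,y₀)) ≤ β(S) → 0`,
uniformly over `y₀ ∈ Y_z` and `z ∈ Z`. -/
def Assumption2 (U : Set (Dd d)) (f : Dd d → Em m → Em m) (F : Em m → Kk k)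
    (Z : Set (Kk k)) : Prop :=
  ∃ β : ℝ → ℝ, Tendsto β atTop (𝓝 0) ∧
    ∀ z ∈ Z, ∀ y₀ ∈ lvl F z, ∀ S > (0:ℝ), ∀ μ ∈ W U f F z,
      ρpt μ (Mz U f S y₀) ≤ ENNReal.ofReal (β S)

/-- Optimal value `R^*(ε, y₀)` of the perturbed problem (shrinked time scale). -/
def Rstar (U : Set (Dd d)) (f g : Dd d → Em m → Em m) (r : Dd d → Em m → ℝ)
    (C : ℝ) (y₀ : Em m) (ε : ℝ) : ℝ :=
  sInf {v | ∃ u y, IsControl U u ∧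
    IsSolOn (fun s x => ε⁻¹ • f (u s) x + g (u s) x) y ∧ y 0 = y₀ ∧
    v = ∫ t in Ioi (0:ℝ), Real.exp (-C * t) * r (u t) (y t)}

/-- Optimal value `R̃^*` of the averaged problem. -/
def RtildeStar (U : Set (Dd d)) (f : Dd d → Em m → Em m) (F : Em m → Kk k)
    (g : Dd d → Em m → Em m) (r : Dd d → Em m → ℝ) (C : ℝ) (z₀ : Kk k) : ℝ :=
  sInf {v | ∃ μt z, IsAveragedSol U f F g z₀ μt z ∧
    v = ∫ t in Ioi (0:ℝ), Real.exp (-C * t) * rtilde r (μt t)}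

/-- Bilinear form `wᵀ Q v` of a matrix. -/
def matBil (Q : Matrix (Fin m) (Fin m) ℝ) (w v : Em m) : ℝ :=
  ∑ i, w i * Q.mulVec (fun j => v j) i

/-- The pair `(u(·), y(·))` generates the occupational measure `μ` on `[0,∞)`. -/
def GeneratesOM (u : ℝ → Dd d) (y : ℝ → Em m) (μ : Measure (Dd d × Em m)) : Prop :=
  IsProbabilityMeasure μ ∧ ∀ q : Dd d × Em m → ℝ, Continuous q →
    Tendsto (fun S : ℝ => S⁻¹ * ∫ τ in (0:ℝ)..S, q (u τ, y τ)) atTop (𝓝 (∫ p, q p ∂μ))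

/-- An average control generating (ACG) family `(u_z(·), y_z(·))` with occupational
measures `μ_z` and the (unique) solution `zsol` of `z'(t) = h̃(μ_{z(t)})`, `z 0 = z₀`. -/
def IsACG (U : Set (Dd d)) (f : Dd d → Em m → Em m) (F : Em m → Kk k)
    (g : Dd d → Em m → Em m) (Z : Set (Kk k)) (z₀ : Kk k)
    (uz : Kk k → ℝ → Dd d) (yz : Kk k → ℝ → Em m)
    (μz : Kk k → Measure (Dd d × Em m)) (zsol : ℝ → Kk k) : Prop :=
  (∀ z ∈ Z, IsControl U (uz z)) ∧
  (∀ z ∈ Z, IsSolOn (fun s x => f (uz z s) x) (yz z)) ∧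
  (∀ z ∈ Z, ∀ τ : ℝ, 0 ≤ τ → yz z τ ∈ lvl F z) ∧
  (∀ z ∈ Z, IsProbabilityMeasure (μz z)) ∧
  (∀ q : Dd d × Em m → ℝ, Continuous q →
    ∃ αq : ℝ → ℝ, Tendsto αq atTop (𝓝 0) ∧ ∀ z ∈ Z, ∀ S > (0:ℝ),
      |S⁻¹ * (∫ τ in (0:ℝ)..S, q (uz z τ, yz z τ)) - ∫ p, q p ∂(μz z)| ≤ αq S) ∧
  (∀ q : Dd d × Em m → ℝ, Continuous q → Measurable fun z => ∫ p, q p ∂(μz z)) ∧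
  zsol 0 = z₀ ∧ ContinuousOn zsol (Ici 0) ∧
  (∀ T : ℝ, IntervalIntegrable (fun s => htilde F g (μz (zsol s))) volume 0 T) ∧
  (∀ t : ℝ, 0 ≤ t → zsol t = z₀ + ∫ s in (0:ℝ)..t, htilde F g (μz (zsol s))) ∧
  (∀ t : ℝ, 0 ≤ t → zsol t ∈ Z) ∧
  (∀ w : ℝ → Kk k, w 0 = z₀ → ContinuousOn w (Ici 0) →
    (∀ T : ℝ, IntervalIntegrable (fun s => htilde F g (μz (w s))) volume 0 T) →
    (∀ t : ℝ, 0 ≤ t → w t = z₀ + ∫ s in (0:ℝ)..t, htilde F g (μz (w s))) →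
    (∀ t : ℝ, 0 ≤ t → w t ∈ Z) → ∀ t : ℝ, 0 ≤ t → w t = zsol t)

/-- Periodicity of an ACG family. -/
def ACGPeriodic (Z : Set (Kk k)) (uz : Kk k → ℝ → Dd d) (yz : Kk k → ℝ → Em m) : Prop :=
  ∀ z ∈ Z, ∃ T > (0:ℝ), ∀ τ : ℝ, 0 ≤ τ →
    uz z (τ + T) = uz z τ ∧ yz z (τ + T) = yz z τ

/-- Optimality of an ACG family in the averaged problem. -/
def ACGOptimal (U : Set (Dd d)) (f : Dd d → Em m → Em m) (F : Em m → Kk k)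
    (g : Dd d → Em m → Em m) (r : Dd d → Em m → ℝ) (C : ℝ) (z₀ : Kk k)
    (μz : Kk k → Measure (Dd d × Em m)) (zsol : ℝ → Kk k) : Prop :=
  (∫ t in Ioi (0:ℝ), Real.exp (-C * t) * rtilde r (μz (zsol t))) =
    RtildeStar U f F g r C z₀

/-- The set `D̃(z₀)` of discounted occupational measures supported on the graph of `W`. -/
def Dtilde (U : Set (Dd d)) (f : Dd d → Em m → Em m) (F : Em m → Kk k)
    (g : Dd d → Em m → Em m) (Z : Set (Kk k)) (C : ℝ) (z₀ : Kk k) :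
    Set (Measure (Measure (Dd d × Em m) × Kk k)) :=
  {p | IsProbabilityMeasure p ∧ p {q | q.2 ∈ Z ∧ q.1 ∈ W U f F q.2} = 1 ∧
    ∀ ψ : Kk k → ℝ, ContDiff ℝ 1 ψ →
      ∫ q, (fderiv ℝ ψ q.2 (htilde F g q.1) + C * (ψ z₀ - ψ q.2)) ∂p = 0}

/-- `ã^*(z₀)`: the optimal value of the IDLP problem. -/
def astar (U : Set (Dd d)) (f : Dd d → Em m → Em m) (F : Em m → Kk k)
    (g : Dd d → Em m → Em m) (r : Dd d → Em m → ℝ) (Z : Set (Kk k)) (C : ℝ)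
    (z₀ : Kk k) : ℝ :=
  sInf ((fun p => ∫ q, rtilde r q.1 ∂p) '' Dtilde U f F g Z C z₀)

/-- The Hamiltonian `H̃(p,z)` of the averaged system (`p` a linear functional). -/
def Htilde (U : Set (Dd d)) (f : Dd d → Em m → Em m) (F : Em m → Kk k)
    (g : Dd d → Em m → Em m) (r : Dd d → Em m → ℝ) (p : Kk k →L[ℝ] ℝ) (z : Kk k) : ℝ :=
  sInf ((fun μ => rtilde r μ + p (htilde F g μ)) '' W U f F z)

/-- Assumption V: existence of solutions `ζ*` of the averaged dual problem and `η*_z`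
of the associated dual problems. -/
def AssumptionV (U : Set (Dd d)) (f : Dd d → Em m → Em m) (F : Em m → Kk k)
    (g : Dd d → Em m → Em m) (r : Dd d → Em m → ℝ) (Z : Set (Kk k)) (C : ℝ)
    (z₀ : Kk k) (ζs : Kk k → ℝ) (ηs : Kk k → Em m → ℝ) : Prop :=
  ContDiff ℝ 1 ζs ∧ (∀ z, ContDiff ℝ 1 (ηs z)) ∧
  IsLeast ((fun z => Htilde U f F g r (fderiv ℝ ζs z) z + C * (ζs z₀ - ζs z)) '' Z)
    (astar U f F g r Z C z₀) ∧
  ∀ z ∈ Z, IsLeast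
    ((fun p : Dd d × Em m =>
        r p.1 p.2 + fderiv ℝ ζs z (hObs F g p) + fderiv ℝ (ηs z) p.2 (f p.1 p.2)) ''
      (U ×ˢ lvl F z))
    (Htilde U f F g r (fderiv ℝ ζs z) z)

/-- The occupational measure of a `T`-periodic orbit `y(·)` (a measure on the state space). -/
def perOcc (y : ℝ → Em m) (T : ℝ) : Measure (Em m) :=
  (ENNReal.ofReal T)⁻¹ • Measure.map y (volume.restrict (Ioc 0 T))

/-- Assumption III: for each `z ∈ Z`, the uncontrolled reduced system has a `T_z`-periodic
solution in `Y_z` (periods uniformly bounded), and every solution starting in `Y_z`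
is a time shift of it. -/
def AssumptionIII (f0 : Em m → Em m) (F : Em m → Kk k) (Z : Set (Kk k))
    (yper : Kk k → ℝ → Em m) (Tper : Kk k → ℝ) : Prop :=
  (∃ T₀ : ℝ, ∀ z ∈ Z, 0 < Tper z ∧ Tper z ≤ T₀) ∧
  (∀ z ∈ Z, IsSolOn (fun _ x => f0 x) (yper z)) ∧
  (∀ z ∈ Z, ∀ τ : ℝ, yper z τ ∈ lvl F z) ∧
  (∀ z ∈ Z, ∀ τ : ℝ, yper z (τ + Tper z) = yper z τ) ∧
  (∀ z ∈ Z, ∀ y : ℝ → Em m, IsSolOn (fun _ x => f0 x) y → y 0 ∈ lvl F z →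
    ∃ s : ℝ, ∀ τ : ℝ, 0 ≤ τ → y τ = yper z (τ + s))

/-- Assumption IV: existence, for each `z ∈ Z`, of a solution `ȳ_z` generating an
occupational measure `ν_z`, which asymptotically attracts (up to time shifts) every
solution staying in `Y_z`. -/
def AssumptionIV (f0 : Em m → Em m) (F : Em m → Kk k) (Z : Set (Kk k))
    (ybar : Kk k → ℝ → Em m) (ν : Kk k → Measure (Em m)) : Prop :=
  (∀ z ∈ Z, IsSolOn (fun _ x => f0 x) (ybar z)) ∧
  (∀ z ∈ Z, ∀ τ : ℝ, 0 ≤ τ → ybar z τ ∈ lvl F z) ∧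
  (∀ z ∈ Z, IsProbabilityMeasure (ν z) ∧ ν z (lvl F z) = 1) ∧
  (∀ q : Em m → ℝ, Continuous q → ∃ κ : ℝ → ℝ, Tendsto κ atTop (𝓝 0) ∧
    ∀ z ∈ Z, ∀ S > (0:ℝ),
      |S⁻¹ * (∫ τ in (0:ℝ)..S, q (ybar z τ)) - ∫ x, q x ∂(ν z)| ≤ κ S) ∧
  (∃ α₁ α₂ : ℝ → ℝ, Tendsto α₁ atTop (𝓝 0) ∧ Tendsto α₂ atTop (𝓝 0) ∧
    (∀ S > (0:ℝ), 0 < α₁ S ∧ 0 < α₂ S) ∧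
    ∀ z ∈ Z, ∀ y : ℝ → Em m, IsSolOn (fun _ x => f0 x) y →
      (∀ τ : ℝ, 0 ≤ τ → y τ ∈ lvl F z) → ∀ S > (0:ℝ),
        ∃ θ : ℝ, 0 ≤ θ ∧ θ / S ≤ α₂ S ∧
          ∀ τ ∈ Icc (0:ℝ) S, ‖y (τ + θ) - ybar z τ‖ ≤ α₁ S)

section Flow

variable {E : Type*} [NormedAddCommGroup E] [NormedSpace ℝ E]

theorem norm_integral_le_of_norm_le_exp {G : ℝ → E} {A c t : ℝ} (hc : 0 < c) (hA : 0 ≤ A)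
    (ht : 0 ≤ t) (hG : ∀ s, 0 ≤ s → ‖G s‖ ≤ A * Real.exp (c * s)) :
    ‖∫ s in (0 : ℝ)..t, G s‖ ≤ A / c * Real.exp (c * t) := by
  have hcont : Continuous fun s : ℝ => A * Real.exp (c * s) := by fun_prop
  have h1 : ‖∫ s in (0 : ℝ)..t, G s‖ ≤ ∫ s in (0 : ℝ)..t, A * Real.exp (c * s) :=
    intervalIntegral.norm_integral_le_of_norm_le ht
      (Eventually.of_forall fun s hs => hG s hs.1.le) (hcont.intervalIntegrable _ _)
  have hderiv : ∀ s ∈ uIcc 0 t,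
      HasDerivAt (fun s : ℝ => A / c * Real.exp (c * s)) (A * Real.exp (c * s)) s := by
    intro s _
    have h := (((hasDerivAt_id s).const_mul c).exp).const_mul (A / c)
    refine h.congr_deriv ?_
    simp only [id]
    field_simp
  rw [intervalIntegral.integral_eq_sub_of_hasDerivAt hderiv (hcont.intervalIntegrable _ _)] at h1
  have : 0 ≤ A / c * Real.exp (c * 0) := by positivity
  linarith

/-- A globally Lipschitz autonomous ODE has a solution on `[0, ∞)` for every initial value. -/
theorem exists_global_solution [CompleteSpace E] {f : E → E} {K : ℝ≥0} (hf : LipschitzWith K f)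
    (x : E) :
    ∃ y : ℝ → E, Continuous y ∧ ∀ t, 0 ≤ t → y t = x + ∫ s in (0 : ℝ)..t, f (y s) := by
  set c : ℝ := K + 1 with hc
  have hcpos : 0 < c := by positivity
  let G : (BoundedContinuousFunction ℝ E) → ℝ → E := fun u s => f (Real.exp (c * s) • u s)
  have hGc : ∀ u, Continuous (G u) := fun u => hf.continuous.comp (by fun_prop)
  have hGb : ∀ u s, 0 ≤ s → ‖G u s‖ ≤ (‖f 0‖ + K * ‖u‖) * Real.exp (c * s) := by
    intro u s hs
    have h1 : ‖G u s - f 0‖ ≤ K * ‖Real.exp (c * s) • u s - 0‖ := hf.norm_sub_le _ _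
    rw [sub_zero, norm_smul, Real.norm_eq_abs, abs_of_pos (Real.exp_pos _)] at h1
    have h2 : ‖G u s‖ ≤ ‖G u s - f 0‖ + ‖f 0‖ := by
      simpa using norm_add_le (G u s - f 0) (f 0)
    have h3 : 1 ≤ Real.exp (c * s) := Real.one_le_exp (by positivity)
    have h4 : (K : ℝ) * (Real.exp (c * s) * ‖u s‖) ≤ K * (Real.exp (c * s) * ‖u‖) := by
      gcongr
      exact u.norm_coe_le_norm s
    nlinarith [norm_nonneg (f 0)]
  have hGl : ∀ u v s, ‖G u s - G v s‖ ≤ K * ‖u - v‖ * Real.exp (c * s) := by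
    intro u v s
    have h1 : ‖G u s - G v s‖ ≤ K * ‖Real.exp (c * s) • u s - Real.exp (c * s) • v s‖ :=
      hf.norm_sub_le _ _
    rw [← smul_sub, norm_smul, Real.norm_eq_abs, abs_of_pos (Real.exp_pos _)] at h1
    have h4 : (K : ℝ) * (Real.exp (c * s) * ‖u s - v s‖) ≤
        K * (Real.exp (c * s) * ‖u - v‖) := by
      gcongr
      exact (u - v).norm_coe_le_norm s
    linarith
  let P : (BoundedContinuousFunction ℝ E) → ℝ → E := fun u t =>
    Real.exp (-(c * max t 0)) • (x + ∫ s in (0 : ℝ)..(max t 0), G u s)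
  have hPc : ∀ u, Continuous (P u) := by
    intro u
    have h1 : Continuous fun t : ℝ => ∫ s in (0 : ℝ)..t, G u s :=
      intervalIntegral.continuous_primitive (fun a b => (hGc u).intervalIntegrable a b) 0
    have h2 : Continuous fun t : ℝ => max t 0 := by fun_prop
    have h3 : Continuous fun t : ℝ => ∫ s in (0 : ℝ)..(max t 0), G u s := h1.comp h2
    exact Continuous.smul (by fun_prop) (continuous_const.add h3)
  have hPb : ∀ u t, ‖P u t‖ ≤ ‖x‖ + (‖f 0‖ + K * ‖u‖) / c := by
    intro u t
    have ht : 0 ≤ max t 0 := le_max_right _ _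
    have h1 := norm_integral_le_of_norm_le_exp hcpos (by positivity) ht (hGb u)
    simp only [P, norm_smul, Real.norm_eq_abs, abs_of_pos (Real.exp_pos _)]
    have h2 : ‖x + ∫ s in (0 : ℝ)..(max t 0), G u s‖ ≤
        ‖x‖ + (‖f 0‖ + K * ‖u‖) / c * Real.exp (c * max t 0) :=
      (norm_add_le _ _).trans (by gcongr)
    have h3 : Real.exp (-(c * max t 0)) * Real.exp (c * max t 0) = 1 := by
      rw [← Real.exp_add]; simp
    have h4 : Real.exp (-(c * max t 0)) ≤ 1 := Real.exp_le_one_iff.2 (by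
      have : 0 ≤ c * max t 0 := by positivity
      linarith)
    calc _ ≤ Real.exp (-(c * max t 0)) *
          (‖x‖ + (‖f 0‖ + K * ‖u‖) / c * Real.exp (c * max t 0)) := by gcongr
      _ = Real.exp (-(c * max t 0)) * ‖x‖ + (‖f 0‖ + K * ‖u‖) / c *
          (Real.exp (-(c * max t 0)) * Real.exp (c * max t 0)) := by ring
      _ ≤ _ := by rw [h3]; nlinarith [norm_nonneg x]
  let Q : (BoundedContinuousFunction ℝ E) → (BoundedContinuousFunction ℝ E) := fun u =>
    BoundedContinuousFunction.ofNormedAddCommGroup (P u) (hPc u) _ (hPb u)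
  have hQ : ContractingWith (K / (K + 1)) Q := by
    refine ⟨?_, LipschitzWith.of_dist_le_mul fun u v => ?_⟩
    · rw [div_lt_one (by positivity)]
      exact lt_add_one K
    · rw [BoundedContinuousFunction.dist_le (by positivity)]
      intro t
      have ht : 0 ≤ max t 0 := le_max_right _ _
      change dist (P u t) (P v t) ≤ _
      have h1 := norm_integral_le_of_norm_le_exp hcpos (by positivity) ht
        (fun s _ => hGl u v s)
      have h2 : P u t - P v t =
          Real.exp (-(c * max t 0)) • ∫ s in (0 : ℝ)..(max t 0), (G u s - G v s) := by
        rw [intervalIntegral.integral_sub ((hGc u).intervalIntegrable _ _)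
          ((hGc v).intervalIntegrable _ _)]
        simp only [P]
        rw [← smul_sub]
        congr 1
        abel
      have h3 : Real.exp (-(c * max t 0)) * Real.exp (c * max t 0) = 1 := by
        rw [← Real.exp_add]; simp
      rw [dist_eq_norm, h2, norm_smul, Real.norm_eq_abs, abs_of_pos (Real.exp_pos _),
        dist_eq_norm]
      calc _ ≤ Real.exp (-(c * max t 0)) * (K * ‖u - v‖ / c * Real.exp (c * max t 0)) := by
            gcongr
        _ = K * ‖u - v‖ / c * (Real.exp (-(c * max t 0)) * Real.exp (c * max t 0)) := by ring
        _ = _ := by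
          rw [h3, hc]
          push_cast
          ring
  obtain ⟨u, hu⟩ : ∃ u, Q u = u := ⟨_, hQ.fixedPoint_isFixedPt⟩
  refine ⟨fun t => Real.exp (c * max t 0) • u t, by fun_prop, fun t ht => ?_⟩
  have h1 : u t = P u t := by
    conv_lhs => rw [← hu]
    rfl
  have h2 : ∫ s in (0 : ℝ)..t, f (Real.exp (c * max s 0) • u s) =
      ∫ s in (0 : ℝ)..t, G u s := by
    refine intervalIntegral.integral_congr fun s hs => ?_
    rw [uIcc_of_le ht] at hs
    simp only [G, max_eq_left hs.1]
  simp only [h2]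
  rw [h1]
  simp only [P, max_eq_left ht]
  rw [smul_smul, ← Real.exp_add]
  simp

/-- `y` is continuous and solves `y' = f(y)`, `y 0 = x` on `[0, ∞)` in integral form. -/
structure IsForwardSol (f : E → E) (x : E) (y : ℝ → E) : Prop where
  cont : Continuous y
  eq_add_integral : ∀ t, 0 ≤ t → y t = x + ∫ s in (0 : ℝ)..t, f (y s)

namespace IsForwardSol

variable {f : E → E} {K : ℝ≥0} {x x' : E} {y y' : ℝ → E}

theorem zero (h : IsForwardSol f x y) : y 0 = x := by
  simpa using h.eq_add_integral 0 le_rfl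

theorem sub_eq_integral (h : IsForwardSol f x y) (hf : Continuous f) {s t : ℝ} (hs : 0 ≤ s)
    (ht : 0 ≤ t) : y t - y s = ∫ τ in s..t, f (y τ) := by
  have hi : ∀ a b, IntervalIntegrable (fun τ => f (y τ)) volume a b :=
    fun a b => (hf.comp h.cont).intervalIntegrable a b
  rw [h.eq_add_integral t ht, h.eq_add_integral s hs,
    ← intervalIntegral.integral_add_adjacent_intervals (hi 0 s) (hi s t)]
  abel

theorem hasDerivWithinAt [CompleteSpace E] (h : IsForwardSol f x y) (hf : Continuous f) {t : ℝ}
    (ht : 0 ≤ t) : HasDerivWithinAt y (f (y t)) (Ici 0) t := by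
  have h1 : HasDerivAt (fun t => x + ∫ s in (0 : ℝ)..t, f (y s)) (f (y t)) t :=
    ((hf.comp h.cont).integral_hasStrictDerivAt 0 t).hasDerivAt.const_add x
  exact h1.hasDerivWithinAt.congr (fun s hs => h.eq_add_integral s hs) (h.eq_add_integral t ht)

theorem shift (h : IsForwardSol f x y) (hf : Continuous f) {s : ℝ} (hs : 0 ≤ s) :
    IsForwardSol f (y s) (fun t => y (s + t)) := by
  refine ⟨h.cont.comp (by fun_prop), fun t ht => ?_⟩
  have h1 := h.sub_eq_integral hf hs (add_nonneg hs ht)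
  have h2 : ∫ τ in (0 : ℝ)..t, f (y (s + τ)) = ∫ τ in s..(s + t), f (y τ) := by
    rw [intervalIntegral.integral_comp_add_left (fun τ => f (y τ))]
    simp
  rw [h2, ← h1]
  abel

theorem dist_le [CompleteSpace E] (h : IsForwardSol f x y) (h' : IsForwardSol f x' y')
    (hf : LipschitzWith K f) {t : ℝ} (ht : 0 ≤ t) :
    dist (y t) (y' t) ≤ dist x x' * Real.exp (K * t) := by
  have := dist_le_of_trajectories_ODE (v := fun _ => f) (K := K) (f := y) (g := y') (a := 0)
    (b := t) (δ := dist x x') (fun _ => hf) h.cont.continuousOn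
    (fun s hs => (h.hasDerivWithinAt hf.continuous hs.1).mono (Ici_subset_Ici.2 hs.1))
    h'.cont.continuousOn
    (fun s hs => (h'.hasDerivWithinAt hf.continuous hs.1).mono (Ici_subset_Ici.2 hs.1))
    (by rw [h.zero, h'.zero]) t ⟨ht, le_rfl⟩
  simpa using this

theorem unique [CompleteSpace E] (h : IsForwardSol f x y) (h' : IsForwardSol f x y')
    (hf : LipschitzWith K f) {t : ℝ} (ht : 0 ≤ t) : y t = y' t := by
  have := h.dist_le h' hf ht
  rw [dist_self, zero_mul] at this
  exact dist_le_zero.1 this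

/-- Speed bounds are bounds on the increments. -/
theorem norm_sub_le (h : IsForwardSol f x y) (hf : Continuous f) {s t M : ℝ}
    (hs : 0 ≤ s) (ht : 0 ≤ t) (hM : ∀ τ ∈ uIcc s t, ‖f (y τ)‖ ≤ M) :
    ‖y t - y s‖ ≤ M * |t - s| := by
  rw [h.sub_eq_integral hf hs ht]
  exact intervalIntegral.norm_integral_le_of_norm_le_const fun τ hτ => hM τ (uIoc_subset_uIcc hτ)

end IsForwardSol

end Flow

section Mollification

variable {E : Type*} [NormedAddCommGroup E] [NormedSpace ℝ E] [FiniteDimensional ℝ E]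
  [MeasurableSpace E] [BorelSpace E]

/-- A Friedrichs-type lemma: if the Lipschitz function `w` has the Lipschitz derivative `q` along
the Lipschitz vector field `f`, then `q` is a uniform limit of derivatives along `f` of `C¹`
functions. -/
theorem exists_contDiff_fderiv_apply_near {f : E → E} {w q : E → ℝ} {K Kw Kq : ℝ≥0}
    (hf : LipschitzWith K f) (hw : LipschitzWith Kw w) (hq : LipschitzWith Kq q)
    (h : ∀ x, ∃ C : ℝ, ∀ p ∈ ball x 1, ∀ δ ∈ Ioc (0 : ℝ) 1,
      |w (p + δ • f p) - w p - δ * q p| ≤ C * δ ^ 2) {ε : ℝ} (hε : 0 < ε) :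
    ∃ ψ : E → ℝ, ContDiff ℝ 1 ψ ∧ ∀ x, |fderiv ℝ ψ x (f x) - q x| ≤ ε := by
  let μ : Measure E := Measure.addHaar
  set a : ℝ := Kw * K + Kq with ha
  have ha0 : 0 ≤ a := by positivity
  set ρ : ℝ := min (1 / 2) (ε / (a + 1)) with hρ
  have hρ0 : 0 < ρ := lt_min (by norm_num) (by positivity)
  have hρ1 : ρ < 1 := (min_le_left _ _).trans_lt (by norm_num)
  have hρa : a * ρ ≤ ε := by
    have h1 : ρ ≤ ε / (a + 1) := min_le_right _ _
    rw [le_div_iff₀ (by positivity)] at h1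
    nlinarith
  let b : ContDiffBump (0 : E) := ⟨ρ / 2, ρ, by positivity, by linarith⟩
  let η : E → ℝ := b.normed μ
  have hη0 : ∀ t, 0 ≤ η t := fun t => b.nonneg_normed t
  have hη1 : ∫ t, η t ∂μ = 1 := b.integral_normed
  have hηi : Integrable η μ := b.integrable_normed
  have hηc : Continuous η := b.continuous_normed
  have hηs : HasCompactSupport η := b.hasCompactSupport_normed
  have hηsupp : ∀ t, η t ≠ 0 → ‖t‖ < ρ := by
    intro t ht
    have h1 : t ∈ Function.support η := ht
    rw [b.support_normed_eq] at h1
    simpa using h1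
  let ψ : E → ℝ := convolution η w (ContinuousLinearMap.lsmul ℝ ℝ) μ
  have hψ : ∀ x, ψ x = ∫ t, η t * w (x - t) ∂μ := fun x => rfl
  have hψc : ContDiff ℝ 1 ψ := by
    have : ContDiff ℝ ((1 : ℕ∞) : WithTop ℕ∞) ψ :=
      hηs.contDiff_convolution_left (n := 1) _ b.contDiff_normed
        hw.continuous.locallyIntegrable
    exact_mod_cast this
  have hint : ∀ x, Integrable (fun t => η t * w (x - t)) μ := fun x =>
    (hηc.mul (hw.continuous.comp (by fun_prop))).integrable_of_hasCompactSupport hηs.mul_right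
  refine ⟨ψ, hψc, fun x => ?_⟩
  obtain ⟨C, hC⟩ := h x
  have key : ∀ δ ∈ Ioc (0 : ℝ) 1,
      |ψ (x + δ • f x) - ψ x - δ * q x| ≤ δ * (a * ρ) + C * δ ^ 2 := by
    intro δ hδ
    have h1 : ψ (x + δ • f x) - ψ x - δ * q x =
        ∫ t, η t * (w (x + δ • f x - t) - w (x - t) - δ * q x) ∂μ := by
      have e : (fun t => η t * (w (x + δ • f x - t) - w (x - t) - δ * q x)) =
          fun t => η t * w (x + δ • f x - t) - η t * w (x - t) - η t * (δ * q x) := by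
        funext t; ring
      have hdiff : Integrable (fun t => η t * w (x + δ • f x - t) - η t * w (x - t)) μ :=
        (hint _).sub (hint _)
      rw [e, integral_sub hdiff (hηi.mul_const _),
        integral_sub (hint _) (hint _), integral_mul_const, hη1, one_mul, hψ, hψ]
    have h2 : ∀ t, ‖η t * (w (x + δ • f x - t) - w (x - t) - δ * q x)‖ ≤
        η t * (δ * (a * ρ) + C * δ ^ 2) := by
      intro t
      rw [norm_mul, Real.norm_eq_abs, Real.norm_eq_abs, abs_of_nonneg (hη0 t)]
      by_cases ht : η t = 0
      · simp [ht]
      have htρ := hηsupp t ht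
      refine mul_le_mul_of_nonneg_left ?_ (hη0 t)
      set p := x - t with hp
      have hpx : ‖p - x‖ < ρ := by
        have : p - x = -t := by rw [hp]; abel
        rwa [this, norm_neg]
      have h3 := hC p (by rw [mem_ball, dist_eq_norm]; linarith) δ hδ
      have h4 : |w (x + δ • f x - t) - w (p + δ • f p)| ≤ Kw * (δ * (K * ρ)) := by
        have h5 := hw.norm_sub_le (x + δ • f x - t) (p + δ • f p)
        have h6 : x + δ • f x - t - (p + δ • f p) = δ • (f x - f p) := by
          rw [smul_sub, hp]; abel
        rw [h6, norm_smul, Real.norm_eq_abs δ, abs_of_pos hδ.1, Real.norm_eq_abs] at h5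
        have h7 : ‖f x - f p‖ ≤ K * ρ := (hf.norm_sub_le x p).trans (by
          rw [norm_sub_rev]; gcongr)
        refine h5.trans ?_
        have := hδ.1.le
        gcongr
      have h8 : |q p - q x| ≤ Kq * ρ :=
        (hq.norm_sub_le p x).trans (by gcongr)
      have h9 : w (x + δ • f x - t) - w p - δ * q x = (w (x + δ • f x - t) - w (p + δ • f p)) +
          (w (p + δ • f p) - w p - δ * q p) + δ * (q p - q x) := by ring
      rw [h9]
      have h10 : |δ * (q p - q x)| ≤ δ * (Kq * ρ) := by
        rw [abs_mul, abs_of_pos hδ.1]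
        exact mul_le_mul_of_nonneg_left h8 hδ.1.le
      refine (abs_add_three _ _ _).trans ?_
      rw [ha]
      linarith
    rw [h1, ← Real.norm_eq_abs]
    refine (norm_integral_le_of_norm_le (hηi.mul_const _)
      (Eventually.of_forall h2)).trans_eq ?_
    rw [integral_mul_const, hη1, one_mul]
  have hd : HasDerivAt (fun δ : ℝ => ψ (x + δ • f x)) (fderiv ℝ ψ x (f x)) 0 := by
    have h1 : HasFDerivAt ψ (fderiv ℝ ψ x) (x + (0 : ℝ) • f x) := by
      rw [zero_smul, add_zero]
      exact (hψc.differentiable one_ne_zero x).hasFDerivAt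
    have h2 : HasDerivAt (fun δ : ℝ => x + δ • f x) (f x) 0 := by
      simpa using ((hasDerivAt_id (0 : ℝ)).smul_const (f x)).const_add x
    exact h1.comp_hasDerivAt _ h2
  have hlim := hd.tendsto_slope_zero_right
  have hlim1 := (hlim.sub_const (q x)).abs
  have hlim2 : Tendsto (fun δ : ℝ => a * ρ + C * δ) (𝓝[>] 0) (𝓝 (a * ρ)) := by
    have : Tendsto (fun δ : ℝ => a * ρ + C * δ) (𝓝 0) (𝓝 (a * ρ + C * 0)) :=
      Continuous.tendsto (by fun_prop) 0
    rw [mul_zero, add_zero] at this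
    exact this.mono_left nhdsWithin_le_nhds
  refine (le_of_tendsto_of_tendsto hlim1 hlim2 ?_).trans hρa
  filter_upwards [Ioc_mem_nhdsGT (zero_lt_one : (0 : ℝ) < 1)] with δ hδ
  have h1 := key δ hδ
  simp only [zero_add, zero_smul, add_zero, smul_eq_mul]
  have h2 : δ⁻¹ * (ψ (x + δ • f x) - ψ x) - q x =
      δ⁻¹ * (ψ (x + δ • f x) - ψ x - δ * q x) := by
    have := hδ.1.ne'
    field_simp
  rw [h2, abs_mul, abs_of_pos (inv_pos.2 hδ.1), inv_mul_le_iff₀ hδ.1]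
  linarith

end Mollification

section Invariance

variable {E : Type*} [NormedAddCommGroup E] [NormedSpace ℝ E]

theorem IsForwardSol.lipschitzWith [CompleteSpace E] {f : E → E} {K : ℝ≥0} {Φ : E → ℝ → E}
    (hΦ : ∀ x, IsForwardSol f x (Φ x)) (hf : LipschitzWith K f) {t : ℝ} (ht : 0 ≤ t) :
    LipschitzWith (Real.exp (K * t)).toNNReal (fun x => Φ x t) := by
  refine LipschitzWith.of_dist_le_mul fun x x' => ?_
  rw [Real.coe_toNNReal _ (Real.exp_pos _).le, mul_comm]
  exact (hΦ x).dist_le (hΦ x') hf ht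

/-- Locally in the initial value, solutions have bounded speed on bounded time intervals. -/
theorem IsForwardSol.exists_speed_bound [CompleteSpace E] {f : E → E} {K : ℝ≥0} {Φ : E → ℝ → E}
    (hΦ : ∀ x, IsForwardSol f x (Φ x)) (hf : LipschitzWith K f) (x : E) (T : ℝ) :
    ∃ M : ℝ, 0 ≤ M ∧ ∀ p ∈ ball x 1, ∀ t ∈ Icc 0 T, ‖f (Φ p t)‖ ≤ M := by
  obtain ⟨M, hM⟩ := (isCompact_Icc (a := (0 : ℝ)) (b := T)).exists_bound_of_continuousOn
    (hf.continuous.comp (hΦ x).cont).continuousOn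
  refine ⟨|M| + K * Real.exp (K * T), by positivity, fun p hp t ht => ?_⟩
  have h1 : ‖f (Φ p t) - f (Φ x t)‖ ≤ K * Real.exp (K * T) := by
    refine (hf.norm_sub_le _ _).trans ?_
    gcongr
    rw [← dist_eq_norm]
    refine ((hΦ p).dist_le (hΦ x) hf ht.1).trans ?_
    have h2 : dist p x ≤ 1 := (mem_ball.1 hp).le
    have h3 : Real.exp (K * t) ≤ Real.exp (K * T) := by
      gcongr
      exact ht.2
    calc _ ≤ 1 * Real.exp (K * T) := by gcongr
      _ = _ := one_mul _
  have h4 := hM t ht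
  simp only [Function.comp] at h4
  have h5 : ‖f (Φ p t)‖ ≤ ‖f (Φ p t) - f (Φ x t)‖ + ‖f (Φ x t)‖ := by
    simpa using norm_add_le (f (Φ p t) - f (Φ x t)) (f (Φ x t))
  linarith [le_abs_self M]

/-- The derivative of `x ↦ ∫₀ˢ φ(Φ_t x) dt` along `f` is `φ(Φ_s x) - φ(x)`, with a quadratic
error that is locally uniform in `x`. -/
theorem IsForwardSol.exists_taylor_bound [CompleteSpace E] {f : E → E} {K Kφ : ℝ≥0}
    {Φ : E → ℝ → E} (hΦ : ∀ x, IsForwardSol f x (Φ x)) (hf : LipschitzWith K f) {φ : E → ℝ}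
    (hφ : LipschitzWith Kφ φ) {s : ℝ} (hs : 0 ≤ s) {Kw : ℝ≥0}
    (hw : LipschitzWith Kw fun x => ∫ t in (0 : ℝ)..s, φ (Φ x t)) (x : E) :
    ∃ C : ℝ, ∀ p ∈ ball x 1, ∀ δ ∈ Ioc (0 : ℝ) 1,
      |(∫ t in (0 : ℝ)..s, φ (Φ (p + δ • f p) t)) - (∫ t in (0 : ℝ)..s, φ (Φ p t)) -
        δ * (φ (Φ p s) - φ p)| ≤ C * δ ^ 2 := by
  obtain ⟨M, hM0, hM⟩ := IsForwardSol.exists_speed_bound hΦ hf x (s + 1)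
  refine ⟨Kw * (K * M) + 2 * (Kφ * M), fun p hp δ hδ => ?_⟩
  have hδ0 := hδ.1.le
  have hc : ∀ z, Continuous fun t => φ (Φ z t) := fun z => hφ.continuous.comp (hΦ z).cont
  have hmv : ∀ a b, 0 ≤ a → a ≤ b → b ≤ s + 1 → ‖Φ p b - Φ p a‖ ≤ M * (b - a) := by
    intro a b ha hab hb
    have := (hΦ p).norm_sub_le hf.continuous ha (ha.trans hab) (M := M) (fun τ hτ => by
      rw [uIcc_of_le hab] at hτ
      exact hM p hp τ ⟨ha.trans hτ.1, hτ.2.trans hb⟩)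
    rwa [abs_of_nonneg (sub_nonneg.2 hab)] at this
  have hΦ0 : Φ p 0 = p := (hΦ p).zero
  have h1 : ‖p + δ • f p - Φ p δ‖ ≤ K * M * δ ^ 2 := by
    have e : p + δ • f p - Φ p δ = ∫ τ in (0 : ℝ)..δ, (f p - f (Φ p τ)) := by
      have hfi : IntervalIntegrable (fun τ => f (Φ p τ)) volume 0 δ :=
        (hf.continuous.comp (hΦ p).cont).intervalIntegrable _ _
      rw [intervalIntegral.integral_sub intervalIntegrable_const hfi,
        intervalIntegral.integral_const, (hΦ p).eq_add_integral δ hδ0]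
      simp only [sub_zero]
      abel
    rw [e]
    refine (intervalIntegral.norm_integral_le_of_norm_le_const (C := K * (M * δ))
      fun τ hτ => ?_).trans_eq ?_
    · rw [uIoc_of_le hδ0] at hτ
      refine (hf.norm_sub_le _ _).trans ?_
      have h2 := hmv 0 τ le_rfl hτ.1.le (by linarith [hτ.2, hδ.2])
      rw [hΦ0, sub_zero] at h2
      rw [norm_sub_rev]
      have h3 : M * τ ≤ M * δ := by gcongr; exact hτ.2
      exact mul_le_mul_of_nonneg_left (h2.trans h3) K.2
    · rw [sub_zero, abs_of_pos hδ.1]; ring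
  have h2 : |(∫ t in (0 : ℝ)..s, φ (Φ (p + δ • f p) t)) -
      ∫ t in (0 : ℝ)..s, φ (Φ (Φ p δ) t)| ≤ Kw * (K * M * δ ^ 2) :=
    (hw.norm_sub_le (p + δ • f p) (Φ p δ)).trans (by gcongr)
  have h3 : ∫ t in (0 : ℝ)..s, φ (Φ (Φ p δ) t) = ∫ t in δ..(s + δ), φ (Φ p t) := by
    have e : ∫ t in (0 : ℝ)..s, φ (Φ (Φ p δ) t) = ∫ t in (0 : ℝ)..s, φ (Φ p (t + δ)) := by
      refine intervalIntegral.integral_congr fun t ht => ?_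
      rw [uIcc_of_le hs] at ht
      simp only [add_comm t δ]
      rw [(hΦ (Φ p δ)).unique ((hΦ p).shift hf.continuous hδ0) hf ht.1]
    rw [e, intervalIntegral.integral_comp_add_right (fun t => φ (Φ p t)), zero_add]
  have hi : ∀ a b, IntervalIntegrable (fun t => φ (Φ p t)) volume a b :=
    fun a b => (hc p).intervalIntegrable a b
  have h4 : (∫ t in δ..(s + δ), φ (Φ p t)) - ∫ t in (0 : ℝ)..s, φ (Φ p t) =
      (∫ t in s..(s + δ), φ (Φ p t)) - ∫ t in (0 : ℝ)..δ, φ (Φ p t) := by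
    have e1 := intervalIntegral.integral_add_adjacent_intervals (hi 0 δ) (hi δ (s + δ))
    have e2 := intervalIntegral.integral_add_adjacent_intervals (hi 0 s) (hi s (s + δ))
    linarith
  have h5 : ∀ a, 0 ≤ a → a ≤ s →
      |(∫ t in a..(a + δ), φ (Φ p t)) - δ * φ (Φ p a)| ≤ Kφ * M * δ ^ 2 := by
    intro a ha has
    have e : (∫ t in a..(a + δ), φ (Φ p t)) - δ * φ (Φ p a) =
        ∫ t in a..(a + δ), (φ (Φ p t) - φ (Φ p a)) := by
      rw [intervalIntegral.integral_sub (hi _ _) (by simp), intervalIntegral.integral_const]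
      simp
    rw [e, ← Real.norm_eq_abs]
    refine (intervalIntegral.norm_integral_le_of_norm_le_const (C := Kφ * (M * δ))
      fun τ hτ => ?_).trans_eq ?_
    · rw [uIoc_of_le (by linarith)] at hτ
      refine (hφ.norm_sub_le _ _).trans ?_
      have h6 := hmv a τ ha hτ.1.le (by linarith [hτ.2, hδ.2])
      have h7 : M * (τ - a) ≤ M * δ := by gcongr; linarith [hτ.2]
      exact mul_le_mul_of_nonneg_left (h6.trans h7) Kφ.2
    · rw [add_sub_cancel_left, abs_of_pos hδ.1]; ring
  have h6 := h5 s hs le_rfl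
  have h7 := h5 0 le_rfl hs
  rw [zero_add, hΦ0] at h7
  rw [h3] at h2
  rw [abs_le] at h2 h6 h7 ⊢
  constructor <;> nlinarith [h2.1, h2.2, h6.1, h6.2, h7.1, h7.2]

/-- A compactly supported measure that annihilates `∇ψ · f` for all `C¹` functions `ψ` is
invariant under the flow of the Lipschitz vector field `f`. -/
theorem IsForwardSol.integral_comp_eq [FiniteDimensional ℝ E] [MeasurableSpace E] [BorelSpace E]
    {f : E → E} {K Kφ : ℝ≥0} {Φ : E → ℝ → E} (hΦ : ∀ x, IsForwardSol f x (Φ x))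
    (hf : LipschitzWith K f) {ν : Measure E} [IsProbabilityMeasure ν] {S : Set E}
    (hS : IsCompact S) (hνS : ∀ᵐ x ∂ν, x ∈ S)
    (hν : ∀ ψ : E → ℝ, ContDiff ℝ 1 ψ → ∫ x, fderiv ℝ ψ x (f x) ∂ν = 0)
    {φ : E → ℝ} (hφ : LipschitzWith Kφ φ) {s : ℝ} (hs : 0 ≤ s) :
    ∫ x, φ (Φ x s) ∂ν = ∫ x, φ x ∂ν := by
  have : CompleteSpace E := FiniteDimensional.complete ℝ E
  have hint : ∀ a : E → ℝ, Continuous a → Integrable a ν := by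
    intro a ha
    have := ha.continuousOn.integrableOn_compact (μ := ν) hS
    rwa [IntegrableOn, Measure.restrict_eq_self_of_ae_mem hνS] at this
  have hlip : ∀ t, 0 ≤ t → LipschitzWith (Kφ * (Real.exp (K * t)).toNNReal) fun x => φ (Φ x t) :=
    fun t ht => hφ.comp (IsForwardSol.lipschitzWith hΦ hf ht)
  have hq : LipschitzWith (Kφ * (Real.exp (K * s)).toNNReal + Kφ) fun x => φ (Φ x s) - φ x :=
    (hlip s hs).sub hφ
  have hw : LipschitzWith (Kφ * (Real.exp (K * s)).toNNReal * s.toNNReal)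
      fun x => ∫ t in (0 : ℝ)..s, φ (Φ x t) := by
    refine LipschitzWith.of_dist_le_mul fun x x' => ?_
    have hi : ∀ z, IntervalIntegrable (fun t => φ (Φ z t)) volume 0 s :=
      fun z => (hφ.continuous.comp (hΦ z).cont).intervalIntegrable _ _
    rw [dist_eq_norm, ← intervalIntegral.integral_sub (hi x) (hi x')]
    refine (intervalIntegral.norm_integral_le_of_norm_le_const
      (C := Kφ * Real.exp (K * s) * dist x x') fun τ hτ => ?_).trans_eq ?_
    · rw [uIoc_of_le hs] at hτ
      rw [← dist_eq_norm]
      refine ((hlip τ hτ.1.le).dist_le_mul x x').trans ?_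
      rw [NNReal.coe_mul, Real.coe_toNNReal _ (Real.exp_pos _).le]
      gcongr
      exact hτ.2
    · rw [NNReal.coe_mul, NNReal.coe_mul, Real.coe_toNNReal _ (Real.exp_pos _).le,
        Real.coe_toNNReal _ hs, sub_zero, abs_of_nonneg hs]
      ring
  have hzero : ∫ x, (φ (Φ x s) - φ x) ∂ν = 0 := by
    rw [← abs_eq_zero]
    refine le_antisymm (le_of_forall_pos_le_add fun ε hε => ?_) (abs_nonneg _)
    obtain ⟨ψ, hψ, hψε⟩ := exists_contDiff_fderiv_apply_near hf hw hq
      (fun x => IsForwardSol.exists_taylor_bound hΦ hf hφ hs hw x) hε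
    have hψi : Integrable (fun x => fderiv ℝ ψ x (f x)) ν :=
      hint _ ((hψ.continuous_fderiv one_ne_zero).clm_apply hf.continuous)
    have h1 : ∫ x, (φ (Φ x s) - φ x) ∂ν =
        ∫ x, ((φ (Φ x s) - φ x) - fderiv ℝ ψ x (f x)) ∂ν := by
      rw [integral_sub (hint _ hq.continuous) hψi, hν ψ hψ, sub_zero]
    rw [h1, zero_add, ← Real.norm_eq_abs]
    refine (norm_integral_le_of_norm_le_const (C := ε) (Eventually.of_forall fun x => ?_)).trans_eq
      (by simp)
    rw [norm_sub_rev]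
    exact hψε x
  rw [integral_sub (hint _ (hlip s hs).continuous) (hint _ hφ.continuous)] at hzero
  linarith

end Invariance

section Uniqueness

theorem eq_of_forall_lipschitz_integral_eq {Ω : Type*} [MeasurableSpace Ω] [PseudoEMetricSpace Ω]
    [BorelSpace Ω] (μ ν : Measure Ω) [IsProbabilityMeasure μ] [IsProbabilityMeasure ν]
    (h : ∀ φ : Ω → ℝ, (∃ C : ℝ, ∀ x y, dist (φ x) (φ y) ≤ C) → (∃ L, LipschitzWith L φ) →
      ∫ x, φ x ∂μ = ∫ x, φ x ∂ν) : μ = ν := by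
  let P : ProbabilityMeasure Ω := ⟨μ, inferInstance⟩
  let Q : ProbabilityMeasure Ω := ⟨ν, inferInstance⟩
  have h1 : Tendsto (fun _ : ℕ => P) atTop (𝓝 Q) := by
    rw [tendsto_iff_forall_lipschitz_integral_tendsto]
    intro φ hb hL
    have h2 : ∫ x, φ x ∂(P : Measure Ω) = ∫ x, φ x ∂(Q : Measure Ω) := h φ hb hL
    rw [h2]
    exact tendsto_const_nhds
  have h2 : Q = P := tendsto_nhds_unique h1 tendsto_const_nhds
  exact (congrArg Subtype.val h2).symm

variable {E : Type*} [NormedAddCommGroup E] [NormedSpace ℝ E]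

/-- If all solutions starting in the compact set `S` are time shifts of one periodic function, then
the only probability measure on `S` that annihilates `∇ψ · f` for all `C¹` functions `ψ` is the
occupational measure of any one of these solutions. -/
theorem IsForwardSol.eq_map_of_periodic [FiniteDimensional ℝ E] [MeasurableSpace E] [BorelSpace E]
    {f : E → E} {K : ℝ≥0} {Φ : E → ℝ → E} (hΦ : ∀ x, IsForwardSol f x (Φ x))
    (hf : LipschitzWith K f) {ν : Measure E} [IsProbabilityMeasure ν] {S : Set E}
    (hS : IsCompact S) (hνS : ∀ᵐ x ∂ν, x ∈ S)
    (hν : ∀ ψ : E → ℝ, ContDiff ℝ 1 ψ → ∫ x, fderiv ℝ ψ x (f x) ∂ν = 0)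
    {p : ℝ → E} {T : ℝ} (hT : 0 < T) (hp : Function.Periodic p T)
    (hSp : ∀ x ∈ S, ∃ a, ∀ t, 0 ≤ t → Φ x t = p (t + a)) {x₀ : E} (hx₀ : x₀ ∈ S) :
    ν = Measure.map (fun s => Φ x₀ (T * s)) (volume.restrict (Ioc (0 : ℝ) 1)) := by
  have : CompleteSpace E := FiniteDimensional.complete ℝ E
  have hprob : IsProbabilityMeasure (volume.restrict (Ioc (0 : ℝ) 1)) := ⟨by simp⟩
  have hmc : Continuous fun s => Φ x₀ (T * s) := (hΦ x₀).cont.comp (by fun_prop)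
  have := Measure.isProbabilityMeasure_map (μ := volume.restrict (Ioc (0 : ℝ) 1))
    hmc.measurable.aemeasurable
  refine eq_of_forall_lipschitz_integral_eq _ _ fun φ hb ⟨Kφ, hφ⟩ => ?_
  have hmean : ∀ x ∈ S, ∫ t in (0 : ℝ)..T, φ (Φ x t) = ∫ t in (0 : ℝ)..T, φ (p t) := by
    intro x hx
    obtain ⟨a, ha⟩ := hSp x hx
    have h1 : ∫ t in (0 : ℝ)..T, φ (Φ x t) = ∫ t in (0 : ℝ)..T, φ (p (t + a)) := by
      refine intervalIntegral.integral_congr fun t ht => ?_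
      rw [uIcc_of_le hT.le] at ht
      simp only [ha t ht.1]
    rw [h1, intervalIntegral.integral_comp_add_right (fun t => φ (p t)), zero_add, add_comm T a]
    have := (hp.comp φ).intervalIntegral_add_eq a 0
    simpa using this
  have hright : ∫ x, φ x ∂(Measure.map (fun s => Φ x₀ (T * s)) (volume.restrict (Ioc (0 : ℝ) 1))) =
      T⁻¹ * ∫ t in (0 : ℝ)..T, φ (p t) := by
    rw [integral_map hmc.measurable.aemeasurable hφ.continuous.aestronglyMeasurable,
      ← intervalIntegral.integral_of_le zero_le_one,
      intervalIntegral.integral_comp_mul_left (fun t => φ (Φ x₀ t)) hT.ne', mul_zero, mul_one,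
      hmean x₀ hx₀, smul_eq_mul]
  have hjoint : Continuous fun q : E × ℝ => Φ q.1 (max 0 (min q.2 T)) := by
    refine continuous_prod_of_continuous_lipschitzWith _ (Real.exp (K * T)).toNNReal
      (fun x => (hΦ x).cont.comp (by fun_prop)) fun t => ?_
    refine (IsForwardSol.lipschitzWith hΦ hf (le_max_left 0 (min t T))).weaken ?_
    refine Real.toNNReal_le_toNNReal (Real.exp_le_exp.2 ?_)
    have : max 0 (min t T) ≤ T := max_le hT.le (min_le_right _ _)
    gcongr
  have hclamp : ∀ t ∈ Ioc 0 T, max 0 (min t T) = t := fun t ht => by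
    rw [min_eq_left ht.2, max_eq_right ht.1.le]
  have hbd : ∃ C : ℝ, ∀ x, ‖φ x‖ ≤ C := by
    obtain ⟨C, hC⟩ := hb
    refine ⟨C + ‖φ 0‖, fun x => ?_⟩
    have h1 := hC x 0
    rw [dist_eq_norm] at h1
    have h2 := norm_add_le (φ x - φ 0) (φ 0)
    rw [sub_add_cancel] at h2
    linarith
  obtain ⟨C, hC⟩ := hbd
  have hswap : ∫ x, (∫ t in Ioc 0 T, φ (Φ x (max 0 (min t T)))) ∂ν =
      ∫ t in Ioc 0 T, (∫ x, φ (Φ x (max 0 (min t T))) ∂ν) := by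
    refine integral_integral_swap ?_
    refine Integrable.of_bound (C := C)
      (hφ.continuous.comp hjoint).aestronglyMeasurable (Eventually.of_forall fun _ => hC _)
  have hl : ∫ x, (∫ t in Ioc 0 T, φ (Φ x (max 0 (min t T)))) ∂ν =
      ∫ t in (0 : ℝ)..T, φ (p t) := by
    have : ∀ᵐ x ∂ν, (∫ t in Ioc 0 T, φ (Φ x (max 0 (min t T)))) = ∫ t in (0 : ℝ)..T, φ (p t) := by
      filter_upwards [hνS] with x hx
      rw [← hmean x hx, intervalIntegral.integral_of_le hT.le]
      exact setIntegral_congr_fun measurableSet_Ioc fun t ht => by simp only [hclamp t ht]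
    rw [integral_congr_ae this]
    simp
  have hr : ∫ t in Ioc 0 T, (∫ x, φ (Φ x (max 0 (min t T))) ∂ν) = T * ∫ x, φ x ∂ν := by
    have : ∀ t ∈ Ioc 0 T, (∫ x, φ (Φ x (max 0 (min t T))) ∂ν) = ∫ x, φ x ∂ν := fun t ht => by
      rw [hclamp t ht]
      exact IsForwardSol.integral_comp_eq hΦ hf hS hνS hν hφ ht.1.le
    rw [setIntegral_congr_fun measurableSet_Ioc this]
    simp [hT.le]
  rw [hright, ← hl, hswap, hr, inv_mul_cancel_left₀ hT.ne']

end Uniqueness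

section Coupling

open ProbabilityTheory

/-- A measure on `D × E` whose second marginal is the image of `P` under `q` lifts to a measure on
`Ω × D` with first marginal `P`. -/
theorem exists_lift_of_map_snd_eq_map {Ω D E : Type*} [MeasurableSpace Ω] [MeasurableSpace D]
    [StandardBorelSpace D] [Nonempty D] [MeasurableSpace E] {P : Measure Ω}
    [IsProbabilityMeasure P] {q : Ω → E} (hq : Measurable q) {μ : Measure (D × E)}
    [IsProbabilityMeasure μ] (h : μ.map Prod.snd = P.map q) :
    ∃ π : Measure (Ω × D), IsProbabilityMeasure π ∧ π.map Prod.fst = P ∧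
      π.map (fun p => (p.2, q p.1)) = μ := by
  have := Measure.isProbabilityMeasure_map (μ := μ)
    (measurable_swap (α := D) (β := E)).aemeasurable
  set μ' := μ.map Prod.swap with hμ'
  have hfst : μ'.fst = P.map q := by
    rw [Measure.fst, hμ', Measure.map_map measurable_fst measurable_swap, ← h]
    rfl
  refine ⟨P ⊗ₘ (μ'.condKernel.comap q hq), inferInstance, ?_, ?_⟩
  · exact Measure.fst_compProd P (μ'.condKernel.comap q hq)
  · have hm : Measurable fun p : Ω × D => (q p.1, p.2) := by fun_prop
    have h1 : (P ⊗ₘ (μ'.condKernel.comap q hq)).map (fun p => (q p.1, p.2)) = μ' := by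
      conv_rhs => rw [← μ'.disintegrate μ'.condKernel, hfst]
      have : IsProbabilityMeasure (P.map q) := Measure.isProbabilityMeasure_map hq.aemeasurable
      ext s hs
      rw [Measure.map_apply hm hs, Measure.compProd_apply (hm hs), Measure.compProd_apply hs,
        lintegral_map (Kernel.measurable_kernel_prodMk_left hs) hq]
      rfl
    have h2 : (fun p : Ω × D => (p.2, q p.1)) = Prod.swap ∘ fun p => (q p.1, p.2) := rfl
    rw [h2, ← Measure.map_map measurable_swap hm, h1, hμ',
      Measure.map_map measurable_swap measurable_swap]
    simp

theorem levyProkhorovEDist_map_le {Ω X : Type*} [MeasurableSpace Ω] [MeasurableSpace X]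
    [PseudoMetricSpace X] [OpensMeasurableSpace X] {π : Measure Ω} {a b : Ω → X}
    (ha : Measurable a) (hb : Measurable b) {c : ℝ} (h : ∀ᵐ p ∂π, dist (a p) (b p) ≤ c) :
    levyProkhorovEDist (π.map a) (π.map b) ≤ ENNReal.ofReal c := by
  have key : ∀ (a b : Ω → X), Measurable a → Measurable b → (∀ᵐ p ∂π, dist (a p) (b p) ≤ c) →
      ∀ (ε : ℝ≥0∞) (B : Set X), ENNReal.ofReal c < ε → ε < ∞ → MeasurableSet B →
        π.map a B ≤ π.map b (thickening ε.toReal B) + ε := by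
    intro a b ha hb h ε B hε hε' hB
    rw [Measure.map_apply ha hB, Measure.map_apply hb isOpen_thickening.measurableSet]
    refine (measure_mono_ae ?_).trans le_self_add
    filter_upwards [h] with p hp hpa
    refine mem_thickening_iff.2 ⟨a p, hpa, ?_⟩
    rw [dist_comm]
    exact hp.trans_lt
      ((ENNReal.ofReal_lt_iff_lt_toReal (dist_nonneg.trans hp) hε'.ne).1 hε)
  refine levyProkhorovEDist_le_of_forall _ _ _ fun ε B hε hε' hB =>
    ⟨key a b ha hb h ε B hε hε' hB, key b a hb ha ?_ ε B hε hε' hB⟩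
  simpa only [dist_comm] using h

end Coupling

section Transport

open ProbabilityTheory

variable {f : Em m → Em m} {Φ : Em m → ℝ → Em m} {U : Set (Dd d)} {F : Em m → Kk k}
  {z : Kk k}

theorem ae_mem_of_mem_W {f : Dd d → Em m → Em m} {μ : Measure (Dd d × Em m)} (hμ : μ ∈ W U f F z)
    (hU : IsClosed U) (hz : IsClosed (lvl F z)) : ∀ᵐ p ∂μ, p ∈ U ×ˢ lvl F z := by
  have := hμ.1
  exact (prob_compl_eq_zero_iff (hU.prod hz).measurableSet).2 hμ.2.1

theorem AssumptionIII.exists_shift {Z : Set (Kk k)} {yper : Kk k → ℝ → Em m} {Tper : Kk k → ℝ}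
    (h : AssumptionIII f F Z yper Tper) (hf : Continuous f) (hΦ : ∀ x, IsForwardSol f x (Φ x))
    (hz : z ∈ Z) {x : Em m} (hx : x ∈ lvl F z) :
    ∃ a, ∀ t, 0 ≤ t → Φ x t = yper z (t + a) := by
  refine h.2.2.2.2 z hz (Φ x) ⟨(hΦ x).cont.continuousOn, fun T => ?_, fun t ht => ?_⟩ ?_
  · exact (hf.comp (hΦ x).cont).intervalIntegrable _ _
  · rw [(hΦ x).zero]
    exact (hΦ x).eq_add_integral t ht
  · rwa [(hΦ x).zero]

theorem AssumptionIII.flow_mem {Z : Set (Kk k)} {yper : Kk k → ℝ → Em m} {Tper : Kk k → ℝ}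
    (h : AssumptionIII f F Z yper Tper) (hf : Continuous f) (hΦ : ∀ x, IsForwardSol f x (Φ x))
    (hz : z ∈ Z) {x : Em m} (hx : x ∈ lvl F z) {t : ℝ} (ht : 0 ≤ t) : Φ x t ∈ lvl F z := by
  obtain ⟨a, ha⟩ := h.exists_shift hf hΦ hz hx
  rw [ha t ht]
  exact h.2.2.1 z hz _

theorem AssumptionIII.flow_period {Z : Set (Kk k)} {yper : Kk k → ℝ → Em m} {Tper : Kk k → ℝ}
    (h : AssumptionIII f F Z yper Tper) (hf : Continuous f) (hΦ : ∀ x, IsForwardSol f x (Φ x))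
    (hz : z ∈ Z) {x : Em m} (hx : x ∈ lvl F z) : Φ x (Tper z) = x := by
  obtain ⟨T₀, hT₀⟩ := h.1
  obtain ⟨a, ha⟩ := h.exists_shift hf hΦ hz hx
  rw [ha _ (hT₀ z hz).1.le, add_comm, h.2.2.2.1 z hz a]
  simpa [(hΦ x).zero] using (ha 0 le_rfl).symm

theorem AssumptionIII.map_snd_eq {Z : Set (Kk k)} {yper : Kk k → ℝ → Em m} {Tper : Kk k → ℝ}
    (h : AssumptionIII f F Z yper Tper) {K : ℝ≥0} (hf : LipschitzWith K f)
    (hΦ : ∀ x, IsForwardSol f x (Φ x)) (hU : IsClosed U) (hz : z ∈ Z)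
    (hc : IsCompact (lvl F z)) {x : Em m} (hx : x ∈ lvl F z) {μ : Measure (Dd d × Em m)}
    (hμ : μ ∈ W U (fun _ => f) F z) :
    μ.map Prod.snd = Measure.map (fun s => Φ x (Tper z * s)) (volume.restrict (Ioc (0 : ℝ) 1)) := by
  obtain ⟨T₀, hT₀⟩ := h.1
  have := hμ.1
  have := Measure.isProbabilityMeasure_map (μ := μ)
    (measurable_snd (α := Dd d) (β := Em m)).aemeasurable
  refine IsForwardSol.eq_map_of_periodic hΦ hf hc ?_ (fun ψ hψ => ?_) (hT₀ z hz).1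
    (h.2.2.2.1 z hz) (fun y hy => h.exists_shift hf.continuous hΦ hz hy) hx
  · refine (ae_map_iff measurable_snd.aemeasurable hc.isClosed.measurableSet).2 ?_
    filter_upwards [ae_mem_of_mem_W hμ hU hc.isClosed] with p hp using hp.2
  · rw [integral_map measurable_snd.aemeasurable]
    · exact hμ.2.2 ψ hψ
    · exact ((hψ.continuous_fderiv one_ne_zero).clm_apply hf.continuous).aestronglyMeasurable

theorem integral_fderiv_comp_eq_zero {x : Em m} (hΦ : IsForwardSol f x (Φ x)) (hf : Continuous f)
    {T : ℝ} (hT : 0 < T) (hper : Φ x T = x) {φ : Em m → ℝ} (hφ : ContDiff ℝ 1 φ) :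
    ∫ s in Ioc (0 : ℝ) 1, fderiv ℝ φ (Φ x (T * s)) (f (Φ x (T * s))) = 0 := by
  have hc : Continuous fun t => fderiv ℝ φ (Φ x t) (f (Φ x t)) :=
    ((hφ.continuous_fderiv one_ne_zero).comp hΦ.cont).clm_apply (hf.comp hΦ.cont)
  rw [← intervalIntegral.integral_of_le zero_le_one,
    intervalIntegral.integral_comp_mul_left (fun t => fderiv ℝ φ (Φ x t) (f (Φ x t))) hT.ne',
    mul_zero, mul_one]
  have : ∫ t in (0 : ℝ)..T, fderiv ℝ φ (Φ x t) (f (Φ x t)) = φ (Φ x T) - φ (Φ x 0) := by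
    refine intervalIntegral.integral_eq_sub_of_hasDerivAt_of_le hT.le
      (hφ.continuous.comp hΦ.cont).continuousOn (fun t ht => ?_) (hc.intervalIntegrable _ _)
    have h1 : HasDerivAt (Φ x) (f (Φ x t)) t :=
      (hΦ.hasDerivWithinAt hf ht.1.le).hasDerivAt (Ici_mem_nhds ht.1)
    exact ((hφ.differentiable one_ne_zero).differentiableAt.hasFDerivAt).comp_hasDerivAt t h1
  rw [this, hper, hΦ.zero, sub_self, smul_zero]

theorem AssumptionIII.map_mem_W {Z : Set (Kk k)} {yper : Kk k → ℝ → Em m} {Tper : Kk k → ℝ}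
    (h : AssumptionIII f F Z yper Tper) (hf : Continuous f)
    (hΦ : ∀ x, IsForwardSol f x (Φ x)) (hU : IsClosed U) (hz : z ∈ Z)
    (hc : IsClosed (lvl F z)) {x : Em m} (hx : x ∈ lvl F z) {π : Measure (ℝ × Dd d)}
    [IsProbabilityMeasure π] (hπ : π.map Prod.fst = volume.restrict (Ioc (0 : ℝ) 1))
    (hπI : ∀ᵐ p ∂π, p.1 ∈ Ioc (0 : ℝ) 1) (hπU : ∀ᵐ p ∂π, p.2 ∈ U) :
    π.map (fun p => (p.2, Φ x (Tper z * p.1))) ∈ W U (fun _ => f) F z := by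
  obtain ⟨T₀, hT₀⟩ := h.1
  have hcont : Continuous fun p : ℝ × Dd d => (p.2, Φ x (Tper z * p.1)) :=
    continuous_snd.prodMk ((hΦ x).cont.comp (by fun_prop))
  have hm := hcont.measurable
  refine ⟨Measure.isProbabilityMeasure_map hm.aemeasurable, ?_, fun φ hφ => ?_⟩
  · rw [Measure.map_apply hm (hU.prod hc).measurableSet]
    refine (prob_compl_eq_zero_iff (hm (hU.prod hc).measurableSet)).1 ?_
    have : ∀ᵐ p ∂π, (p.2, Φ x (Tper z * p.1)) ∈ U ×ˢ lvl F z := by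
      filter_upwards [hπI, hπU] with p h1 h2
      exact ⟨h2, h.flow_mem hf hΦ hz hx (mul_nonneg (hT₀ z hz).1.le h1.1.le)⟩
    exact this
  · have hφc : Continuous fun y => fderiv ℝ φ y (f y) :=
      (hφ.continuous_fderiv one_ne_zero).clm_apply hf
    have hs : AEStronglyMeasurable (fun p : Dd d × Em m => fderiv ℝ φ p.2 (f p.2))
        (π.map fun p => (p.2, Φ x (Tper z * p.1))) :=
      (hφc.comp continuous_snd).aestronglyMeasurable
    refine (integral_map hm.aemeasurable hs).trans ?_
    rw [← integral_fderiv_comp_eq_zero (hΦ x) hf (hT₀ z hz).1 (h.flow_period hf hΦ hz hx) hφ, ← hπ,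
      integral_map measurable_fst.aemeasurable]
    exact (hφc.comp
      ((hΦ x).cont.comp (continuous_const_mul (Tper z)))).aestronglyMeasurable

/-- Every measure in `W z'` is carried to a measure in `W z''` by moving its state component along
the orbits through given points of the two level sets. -/
theorem AssumptionIII.exists_transport {Z : Set (Kk k)} {yper : Kk k → ℝ → Em m} {Tper : Kk k → ℝ}
    (h : AssumptionIII f F Z yper Tper) {K : ℝ≥0} (hf : LipschitzWith K f)
    (hΦ : ∀ x, IsForwardSol f x (Φ x)) (hU : IsClosed U) {z' z'' : Kk k} (hz' : z' ∈ Z)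
    (hz'' : z'' ∈ Z) (hc' : IsCompact (lvl F z')) (hc'' : IsClosed (lvl F z''))
    {x' x'' : Em m} (hx' : x' ∈ lvl F z') (hx'' : x'' ∈ lvl F z'') {μ : Measure (Dd d × Em m)}
    (hμ : μ ∈ W U (fun _ => f) F z') :
    ∃ π : Measure (ℝ × Dd d), IsProbabilityMeasure π ∧
      (∀ᵐ p ∂π, p.1 ∈ Ioc (0 : ℝ) 1 ∧ p.2 ∈ U) ∧
      π.map (fun p => (p.2, Φ x' (Tper z' * p.1))) = μ ∧
      π.map (fun p => (p.2, Φ x'' (Tper z'' * p.1))) ∈ W U (fun _ => f) F z'' := by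
  have hq : Continuous fun s => Φ x' (Tper z' * s) := (hΦ x').cont.comp (by fun_prop)
  have : IsProbabilityMeasure (volume.restrict (Ioc (0 : ℝ) 1)) := ⟨by simp⟩
  have := hμ.1
  obtain ⟨π, hπ, hπ1, hπ2⟩ := exists_lift_of_map_snd_eq_map hq.measurable
    (h.map_snd_eq hf hΦ hU hz' hc' hx' hμ)
  have hI : ∀ᵐ p ∂π, p.1 ∈ Ioc (0 : ℝ) 1 := by
    refine (ae_map_iff measurable_fst.aemeasurable measurableSet_Ioc).1 ?_
    rw [hπ1]
    exact ae_restrict_mem measurableSet_Ioc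
  have hπU : ∀ᵐ p ∂π, p.2 ∈ U := by
    have h1 := ae_mem_of_mem_W hμ hU hc'.isClosed
    rw [← hπ2] at h1
    have h2 := (ae_map_iff (measurable_snd.prodMk (hq.measurable.comp measurable_fst)).aemeasurable
      (hU.prod hc'.isClosed).measurableSet).1 h1
    filter_upwards [h2] with p hp using hp.1
  refine ⟨π, hπ, ?_, hπ2, h.map_mem_W hf.continuous hΦ hU hz'' hc'' hx'' hπ1 hI hπU⟩
  filter_upwards [hI, hπU] with p h1 h2 using ⟨h1, h2⟩

end Transport

section Lipschitz

theorem isCompact_lvl {F : Em m → Kk k} {Y : Set (Em m)} (hY : IsCompact Y)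
    (hF : ContinuousOn F Y) {z : Kk k} (hz : lvl F z ⊆ Y) : IsCompact (lvl F z) := by
  have h1 : lvl F z = Y ∩ F ⁻¹' {z} := by
    ext y
    exact ⟨fun h => ⟨hz h, h⟩, fun h => h.2⟩
  rw [h1]
  exact hY.of_isClosed_subset (hF.preimage_isClosed_of_isClosed hY.isClosed isClosed_singleton)
    inter_subset_left

theorem exists_dist_le_hausdorffDist {X : Type*} [MetricSpace X] {s t : Set X} (hs : IsCompact s)
    (ht : IsCompact t) (hs' : s.Nonempty) (ht' : t.Nonempty) :
    ∃ x ∈ s, ∃ y ∈ t, dist x y ≤ hausdorffDist s t := by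
  obtain ⟨x, hx⟩ := hs'
  obtain ⟨y, hy, hxy⟩ := ht.exists_infDist_eq_dist ht' x
  refine ⟨x, hx, y, hy, ?_⟩
  rw [← hxy]
  exact infDist_le_hausdorffDist_of_mem hx
    (hausdorffEDist_ne_top_of_nonempty_of_bounded ⟨x, hx⟩ ht' hs.isBounded ht.isBounded)

/-- Measures in `W z'` and `W z''` can be coupled so that the controls agree and the states are at
distance at most `C * ‖z' - z''‖`. -/
theorem AssumptionIII.exists_coupling {U : Set (Dd d)} {Y : Set (Em m)} {Z : Set (Kk k)}
    {f : Em m → Em m} {F : Em m → Kk k} {yper : Kk k → ℝ → Em m} {Tper : Kk k → ℝ}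
    (h : AssumptionIII f F Z yper Tper) (hU : IsClosed U) (hY : IsCompact Y) {K : ℝ≥0}
    (hf : LipschitzWith K f) (hF : ContinuousOn F Y) (hZY : ∀ z ∈ Z, lvl F z ⊆ Y) {L₀ : ℝ}
    (hL₀ : 0 ≤ L₀)
    (hLip : ∀ z' ∈ Z, ∀ z'' ∈ Z, hausdorffDist (lvl F z') (lvl F z'') ≤ L₀ * ‖z' - z''‖) {L : ℝ}
    (hT : ∀ z' ∈ Z, ∀ z'' ∈ Z,
      |Tper z' - Tper z''| / max (Tper z') (Tper z'') ≤ L * ‖z' - z''‖) :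
    ∃ C : ℝ, 0 ≤ C ∧ ∀ z' ∈ Z, ∀ z'' ∈ Z, ∀ μ ∈ W U (fun _ => f) F z',
      ∃ (π : Measure (ℝ × Dd d)) (a b : ℝ × Dd d → Dd d × Em m), IsProbabilityMeasure π ∧
        Measurable a ∧ Measurable b ∧ π.map a = μ ∧ π.map b ∈ W U (fun _ => f) F z'' ∧
        ∀ᵐ p ∂π, a p ∈ U ×ˢ Y ∧ b p ∈ U ×ˢ Y ∧ (a p).1 = (b p).1 ∧
          dist (a p).2 (b p).2 ≤ C * ‖z' - z''‖ := by
  choose Φ hΦc hΦe using fun x => exists_global_solution hf x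
  have hΦ : ∀ x, IsForwardSol f x (Φ x) := fun x => ⟨hΦc x, hΦe x⟩
  obtain ⟨T₀, hT₀⟩ := h.1
  obtain ⟨M, hM⟩ := hY.exists_bound_of_continuousOn hf.continuous.continuousOn
  have hne : ∀ z ∈ Z, (lvl F z).Nonempty := fun z hz => ⟨_, h.2.2.1 z hz 0⟩
  have hcp : ∀ z ∈ Z, IsCompact (lvl F z) := fun z hz => isCompact_lvl hY hF (hZY z hz)
  refine ⟨Real.exp (K * T₀) * L₀ + |M| * (|L| * |T₀|), by positivity,
    fun z' hz' z'' hz'' μ hμ => ?_⟩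
  obtain ⟨x', hx', x'', hx'', hd⟩ := exists_dist_le_hausdorffDist (hcp z' hz') (hcp z'' hz'')
    (hne z' hz') (hne z'' hz'')
  have hxx : dist x' x'' ≤ L₀ * ‖z' - z''‖ := hd.trans (hLip z' hz' z'' hz'')
  have hTT : |Tper z' - Tper z''| ≤ |L| * |T₀| * ‖z' - z''‖ := by
    have hpos : 0 < max (Tper z') (Tper z'') := lt_max_of_lt_left (hT₀ z' hz').1
    have hle : max (Tper z') (Tper z'') ≤ |T₀| :=
      (max_le (hT₀ z' hz').2 (hT₀ z'' hz'').2).trans (le_abs_self _)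
    calc |Tper z' - Tper z''| ≤ L * ‖z' - z''‖ * max (Tper z') (Tper z'') :=
          (div_le_iff₀ hpos).1 (hT z' hz' z'' hz'')
      _ ≤ |L| * ‖z' - z''‖ * |T₀| := by
          gcongr
          exact le_abs_self L
      _ = _ := by ring
  obtain ⟨π, hπ, hπU, hπ1, hπ2⟩ := h.exists_transport hf hΦ hU hz' hz'' (hcp z' hz')
    (hcp z'' hz'').isClosed hx' hx'' hμ
  have hmeas : ∀ (x : Em m) (T : ℝ), Measurable fun p : ℝ × Dd d => (p.2, Φ x (T * p.1)) :=
    fun x T => (continuous_snd.prodMk ((hΦ x).cont.comp (by fun_prop))).measurable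
  refine ⟨π, _, _, hπ, hmeas x' (Tper z'), hmeas x'' (Tper z''), hπ1, hπ2, ?_⟩
  filter_upwards [hπU] with p ⟨hs, hu⟩
  have hs' : 0 ≤ Tper z' * p.1 := mul_nonneg (hT₀ z' hz').1.le hs.1.le
  have hs'' : 0 ≤ Tper z'' * p.1 := mul_nonneg (hT₀ z'' hz'').1.le hs.1.le
  refine ⟨⟨hu, hZY z' hz' (h.flow_mem hf.continuous hΦ hz' hx' hs')⟩,
    ⟨hu, hZY z'' hz'' (h.flow_mem hf.continuous hΦ hz'' hx'' hs'')⟩, rfl, ?_⟩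
  have h1 : dist (Φ x' (Tper z' * p.1)) (Φ x'' (Tper z' * p.1)) ≤
      Real.exp (K * T₀) * L₀ * ‖z' - z''‖ := by
    have hle : Tper z' * p.1 ≤ T₀ := by nlinarith [hs.1, hs.2, (hT₀ z' hz').1, (hT₀ z' hz').2]
    calc _ ≤ dist x' x'' * Real.exp (K * (Tper z' * p.1)) := (hΦ x').dist_le (hΦ x'') hf hs'
      _ ≤ (L₀ * ‖z' - z''‖) * Real.exp (K * T₀) := by gcongr
      _ = _ := by ring
  have h2 : dist (Φ x'' (Tper z' * p.1)) (Φ x'' (Tper z'' * p.1)) ≤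
      |M| * (|L| * |T₀|) * ‖z' - z''‖ := by
    rw [dist_eq_norm]
    have h3 := (hΦ x'').norm_sub_le hf.continuous hs'' hs' (M := |M|) fun τ hτ => by
      have hτ0 : 0 ≤ τ := (le_min hs'' hs').trans hτ.1
      exact (hM _ (hZY z'' hz'' (h.flow_mem hf.continuous hΦ hz'' hx'' hτ0))).trans
        (le_abs_self M)
    rw [← sub_mul, abs_mul, abs_of_pos hs.1] at h3
    calc _ ≤ |M| * (|Tper z' - Tper z''| * p.1) := h3
      _ ≤ |M| * (|Tper z' - Tper z''| * 1) := by
          gcongr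
          exact hs.2
      _ ≤ |M| * ((|L| * |T₀| * ‖z' - z''‖) * 1) := by gcongr
      _ = _ := by ring
  calc _ ≤ _ := dist_triangle _ (Φ x'' (Tper z' * p.1)) _
    _ ≤ _ := add_le_add h1 h2
    _ = _ := by ring

theorem dist_integral_map_le {Ω D E G : Type*} [MeasurableSpace Ω] [MeasurableSpace D]
    [MeasurableSpace E] [MetricSpace D] [MetricSpace E] [OpensMeasurableSpace (D × E)]
    [NormedAddCommGroup G] [NormedSpace ℝ G] {π : Measure Ω} [IsProbabilityMeasure π]
    {a b : Ω → D × E} (ha : Measurable a) (hb : Measurable b) {S : Set (D × E)} (hS : IsCompact S)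
    {H : D × E → G} (hH : ContinuousOn H S) {c L : ℝ} (hL : 0 ≤ L)
    (hHL : ∀ p ∈ S, ∀ q ∈ S, p.1 = q.1 → ‖H p - H q‖ ≤ L * dist p.2 q.2)
    (h : ∀ᵐ p ∂π, a p ∈ S ∧ b p ∈ S ∧ (a p).1 = (b p).1 ∧ dist (a p).2 (b p).2 ≤ c) :
    dist (∫ p, H p ∂(π.map a)) (∫ p, H p ∂(π.map b)) ≤ L * c := by
  have hint : ∀ e : Ω → D × E, Measurable e → (∀ᵐ p ∂π, e p ∈ S) → Integrable H (π.map e) := by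
    intro e he heS
    have := Measure.isProbabilityMeasure_map (μ := π) he.aemeasurable
    have h1 := hH.integrableOn_compact (μ := π.map e) hS
    rwa [IntegrableOn, Measure.restrict_eq_self_of_ae_mem] at h1
    exact (ae_map_iff he.aemeasurable hS.isClosed.measurableSet).2 heS
  have hia := hint a ha (h.mono fun p hp => hp.1)
  have hib := hint b hb (h.mono fun p hp => hp.2.1)
  have hia' : Integrable (fun p => H (a p)) π := hia.comp_measurable ha
  have hib' : Integrable (fun p => H (b p)) π := hib.comp_measurable hb
  rw [integral_map ha.aemeasurable hia.aestronglyMeasurable,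
    integral_map hb.aemeasurable hib.aestronglyMeasurable, dist_eq_norm,
    ← integral_sub hia' hib']
  refine (norm_integral_le_of_norm_le_const (C := L * c) ?_).trans_eq (by simp)
  filter_upwards [h] with p hp
  exact (hHL _ hp.1 _ hp.2.1 hp.2.2.1).trans (mul_le_mul_of_nonneg_left hp.2.2.2 hL)

theorem continuousOn_hObs {U : Set (Dd d)} {Y V : Set (Em m)} {F : Em m → Kk k}
    {g : Dd d → Em m → Em m} (hYV : Y ⊆ V) (hF : ContinuousOn (fderiv ℝ F) V)
    (hg : Continuous fun p : Dd d × Em m => g p.1 p.2) :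
    ContinuousOn (hObs F g) (U ×ˢ Y) :=
  (hF.comp continuousOn_snd fun _ hp => hYV hp.2).clm_apply hg.continuousOn

theorem exists_hObs_lipschitz {U : Set (Dd d)} {Y V : Set (Em m)} {F : Em m → Kk k}
    {g : Dd d → Em m → Em m} (hU : IsCompact U) (hY : IsCompact Y) (hYV : Y ⊆ V) {LF Lg : ℝ≥0}
    (hF : LipschitzOnWith LF (fderiv ℝ F) V)
    (hg : Continuous fun p : Dd d × Em m => g p.1 p.2) (hgL : ∀ u ∈ U, LipschitzWith Lg (g u)) :
    ∃ L : ℝ, 0 ≤ L ∧ ∀ p ∈ U ×ˢ Y, ∀ q ∈ U ×ˢ Y, p.1 = q.1 →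
      ‖hObs F g p - hObs F g q‖ ≤ L * dist p.2 q.2 := by
  obtain ⟨G, hG⟩ := (hU.prod hY).exists_bound_of_continuousOn hg.continuousOn
  obtain ⟨B, hB⟩ := hY.exists_bound_of_continuousOn (hF.continuousOn.mono hYV)
  refine ⟨LF * |G| + |B| * Lg, by positivity, ?_⟩
  rintro ⟨u, y⟩ hp ⟨u', y'⟩ hq (rfl : u = u')
  have e : hObs F g (u, y) - hObs F g (u, y') =
      (fderiv ℝ F y - fderiv ℝ F y') (g u y) + fderiv ℝ F y' (g u y - g u y') := by
    simp [hObs]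
  have h1 : ‖(fderiv ℝ F y - fderiv ℝ F y') (g u y)‖ ≤ LF * dist y y' * |G| := by
    refine (ContinuousLinearMap.le_opNorm _ _).trans ?_
    gcongr
    · rw [← dist_eq_norm]
      exact hF.dist_le_mul y (hYV hp.2) y' (hYV hq.2)
    · exact (hG (u, y) hp).trans (le_abs_self G)
  have h2 : ‖fderiv ℝ F y' (g u y - g u y')‖ ≤ |B| * (Lg * dist y y') := by
    refine (ContinuousLinearMap.le_opNorm _ _).trans ?_
    gcongr
    · exact (hB y' hq.2).trans (le_abs_self B)
    · rw [← dist_eq_norm]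
      exact (hgL u hp.1).dist_le_mul y y'
  rw [e]
  calc _ ≤ _ := norm_add_le _ _
    _ ≤ _ := add_le_add h1 h2
    _ = _ := by ring

end Lipschitz

/-- Proposition 4.1(iii) of the paper: for an uncontrolled reduced system
satisfying Assumption III, if `z ↦ Y_z` is Lipschitz and the periods satisfy the stated relative
Lipschitz estimate, then `W` is continuous on `Z` and `V` is Lipschitz on `Z`. -/
theorem statement10
    {d m k : ℕ}
    (Uset : Set (Dd d)) (Yset : Set (Em m)) (Zset : Set (Kk k))
    (f0 : Em m → Em m) (F : Em m → Kk k)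
    (hU : IsCompact Uset) (hY : IsCompact Yset) (hZ : IsCompact Zset)
    (hfL : ∃ L : ℝ≥0, LipschitzWith L f0)
    (hF : ∃ V : Set (Em m), IsOpen V ∧ Yset ⊆ V ∧ ContDiffOn ℝ 1 F V ∧
      ∃ LF : ℝ≥0, LipschitzOnWith LF (fun y => fderiv ℝ F y) V)
    (hInv : ∀ y ∈ Yset, fderiv ℝ F y (f0 y) = 0)
    (hYzY : ∀ z ∈ Zset, lvl F z ⊆ Yset)
    (g : Dd d → Em m → Em m) (r : Dd d → Em m → ℝ)
    (hgC : Continuous fun p : Dd d × Em m => g p.1 p.2)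
    (hrC : Continuous fun p : Dd d × Em m => r p.1 p.2)
    (hgL : ∃ L : ℝ≥0, ∀ u ∈ Uset, LipschitzWith L (g u))
    (hrL : ∃ L : ℝ≥0, ∀ u ∈ Uset, LipschitzWith L (r u))
    (yper : Kk k → ℝ → Em m) (Tper : Kk k → ℝ)
    (hIII : AssumptionIII f0 F Zset yper Tper)
    (hYzLip : ∃ L0 : ℝ, 0 ≤ L0 ∧ ∀ z' ∈ Zset, ∀ z'' ∈ Zset,
      hausdorffDist (lvl F z') (lvl F z'') ≤ L0 * ‖z' - z''‖)
    (Ltil : ℝ)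
    (hTLip : ∀ z' ∈ Zset, ∀ z'' ∈ Zset,
      |Tper z' - Tper z''| / max (Tper z') (Tper z'') ≤ Ltil * ‖z' - z''‖) :
    WCont Uset (fun _ : Dd d => f0) F Zset ∧
      VLip Uset (fun _ : Dd d => f0) F g r Zset := by
  obtain ⟨K, hK⟩ := hfL
  obtain ⟨V, -, hYV, hFC, LF, hLF⟩ := hF
  obtain ⟨Lg, hLg⟩ := hgL
  obtain ⟨Lr, hLr⟩ := hrL
  obtain ⟨L0, hL0, hLip⟩ := hYzLip
  obtain ⟨C, hC, hcoup⟩ := hIII.exists_coupling hU.isClosed hY hK (hFC.continuousOn.mono hYV)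
    hYzY hL0 hLip hTLip
  constructor
  · have hpt : ∀ z' ∈ Zset, ∀ z'' ∈ Zset, ∀ μ ∈ W Uset (fun _ => f0) F z',
        ρpt μ (W Uset (fun _ => f0) F z'') ≤ ENNReal.ofReal (C * ‖z' - z''‖) := by
      intro z' hz' z'' hz'' μ hμ
      obtain ⟨π, a, b, -, ha, hb, rfl, hπb, hab⟩ := hcoup z' hz' z'' hz'' μ hμ
      refine (iInf₂_le _ hπb).trans (levyProkhorovEDist_map_le ha hb ?_)
      filter_upwards [hab] with p hp
      rw [Prod.dist_eq, hp.2.2.1, dist_self]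
      exact max_le (by positivity) hp.2.2.2
    intro z hz δ hδ
    obtain ⟨η, hη, hηδ⟩ := ENNReal.lt_iff_exists_nnreal_btwn.1 hδ
    have hη' : (0 : ℝ) < η := by exact_mod_cast hη
    refine ⟨η / (C + 1), by positivity, fun z' hz' hzz => ?_⟩
    have hle : ENNReal.ofReal (C * ‖z' - z‖) ≤ η := by
      rw [← ENNReal.ofReal_coe_nnreal]
      refine ENNReal.ofReal_le_ofReal ?_
      have := (lt_div_iff₀ (by positivity)).1 hzz
      nlinarith [norm_nonneg (z' - z)]
    refine lt_of_le_of_lt ?_ hηδ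
    refine max_le (iSup₂_le fun μ hμ => (hpt z' hz' z hz μ hμ).trans hle)
      (iSup₂_le fun μ hμ => (hpt z hz z' hz' μ hμ).trans ?_)
    rwa [norm_sub_rev]
  · obtain ⟨Lh, hLh, hhL⟩ := exists_hObs_lipschitz hU hY hYV hLF hgC hLg
    have hhC := continuousOn_hObs (U := Uset) hYV hLF.continuousOn hgC
    have hrL' : ∀ p ∈ Uset ×ˢ Yset, ∀ q ∈ Uset ×ˢ Yset, p.1 = q.1 →
        ‖r p.1 p.2 - r q.1 q.2‖ ≤ Lr * dist p.2 q.2 := by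
      rintro ⟨u, y⟩ hp ⟨u', y'⟩ - (rfl : u = u')
      rw [← dist_eq_norm]
      exact (hLr u hp.1).dist_le_mul y y'
    have hdist : ∀ z' ∈ Zset, ∀ z'' ∈ Zset, ∀ v ∈ Vmap Uset (fun _ => f0) F g r z',
        ∃ w ∈ Vmap Uset (fun _ => f0) F g r z'',
          dist v w ≤ max (Lh * C) (Lr * C) * ‖z' - z''‖ := by
      rintro z' hz' z'' hz'' _ ⟨μ, hμ, rfl⟩
      obtain ⟨π, a, b, hπ, ha, hb, rfl, hπb, hab⟩ := hcoup z' hz' z'' hz'' μ hμ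
      refine ⟨_, ⟨_, hπb, rfl⟩, ?_⟩
      rw [Prod.dist_eq, max_mul_of_nonneg _ _ (norm_nonneg _), mul_assoc, mul_assoc]
      exact max_le_max
        (dist_integral_map_le ha hb (hU.prod hY) hhC hLh hhL hab)
        (dist_integral_map_le ha hb (hU.prod hY) hrC.continuousOn Lr.2 hrL' hab)
    refine ⟨max (Lh * C) (Lr * C), le_max_of_le_left (by positivity), fun z' hz' z'' hz'' => ?_⟩
    refine hausdorffDist_le_of_mem_dist
      (mul_nonneg (le_max_of_le_left (by positivity)) (norm_nonneg _)) (hdist z' hz' z'' hz'') ?_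
    rw [norm_sub_rev]
    exact hdist z'' hz'' z' hz'

end SlowObs
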